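/- Every infinite-dimensional Banach space X satisfies: the infimum over all equivalent renormings X̃ of the Whitley thickness constant T(X̃) equals 1, and the supremum over all equivalent renormings equals 2. That is, inf T(X̃) = 1 and sup T(X̃) = 2. -/

import Mathlib

noncomputable section
open Metric Set

/-- The Kottman constant of a normed space. -/
def kottman (X : Type*) [NormedAddCommGroup X] : ℝ :=
  sSup {σ : ℝ | 0 < σ ∧ ∃ x : ℕ → X, (∀ n, ‖x n‖ ≤ 1) ∧
    ∀ n m, n ≠ m → σ ≤ ‖x n - x m‖}

def symKottman (X : Type*) [NormedAddCommGroup X] : ℝ :=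
  sSup {σ : ℝ | 0 < σ ∧ ∃ x : ℕ → X, (∀ n, ‖x n‖ ≤ 1) ∧
    ∀ n m, n ≠ m → σ ≤ ‖x n - x m‖ ∧ σ ≤ ‖x n + x m‖}

def finKottman (X : Type*) [NormedAddCommGroup X] : ℝ :=
  sSup {σ : ℝ | 0 < σ ∧ ∀ N : ℕ, ∃ x : Fin N → X, (∀ n, ‖x n‖ ≤ 1) ∧
    ∀ n m, n ≠ m → σ ≤ ‖x n - x m‖}

/-- The gap between two subsets (typically closed subspaces) of a normed space,
measured between their unit balls. -/
def gap {Z : Type*} [NormedAddCommGroup Z] (M N : Set Z) : ℝ :=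
  max (sSup ((fun x => Metric.infDist x (N ∩ Metric.closedBall 0 1)) '' (M ∩ Metric.closedBall 0 1)))
      (sSup ((fun y => Metric.infDist y (M ∩ Metric.closedBall 0 1)) '' (N ∩ Metric.closedBall 0 1)))

/-- The Kadets distance between two Banach spaces. -/
def kadets (X Y : Type*) [NormedAddCommGroup X] [NormedSpace ℝ X]
    [NormedAddCommGroup Y] [NormedSpace ℝ Y] : ℝ :=
  sInf {d : ℝ | ∃ (W : Type) (nW : NormedAddCommGroup W) (sW : NormedSpace ℝ W)
    (cW : CompleteSpace W) (i : X →ₗᵢ[ℝ] W) (j : Y →ₗᵢ[ℝ] W),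
    d = gap (Set.range i) (Set.range j)}

/-- The isomorphic Kottman constant: infimum of Kottman constants over all
Banach spaces isomorphic to `X`. -/
def ikottman (X : Type) [NormedAddCommGroup X] [NormedSpace ℝ X] : ℝ :=
  sInf {k : ℝ | ∃ (V : Type) (nV : NormedAddCommGroup V) (sV : NormedSpace ℝ V)
    (cV : CompleteSpace V) (e : X ≃L[ℝ] V), k = kottman V}

/-- Whitley's thickness constant. -/
def whitley (X : Type*) [NormedAddCommGroup X] : ℝ :=
  sInf {ε : ℝ | 0 < ε ∧ ∃ F : Finset X, (∀ f ∈ F, ‖f‖ = 1) ∧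
    ∀ x : X, ‖x‖ = 1 → ∃ f ∈ F, ‖x - f‖ ≤ ε}

/-- The James constant. -/
def james (X : Type*) [NormedAddCommGroup X] : ℝ :=
  sSup {t : ℝ | ∃ x y : X, ‖x‖ = 1 ∧ ‖y‖ = 1 ∧ t = min ‖x - y‖ ‖x + y‖}

def gconst (X : Type*) [NormedAddCommGroup X] : ℝ :=
  sInf {t : ℝ | ∃ x y : X, ‖x‖ = 1 ∧ ‖y‖ = 1 ∧ t = max ‖x - y‖ ‖x + y‖}

/-! ### General facts about the thickness constant -/

theorem exists_lt_dist_lt_of_norm_le {E : Type*} [NormedAddCommGroup E] [ProperSpace E]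
    {v : ℕ → E} {C : ℝ} (hv : ∀ n, ‖v n‖ ≤ C) {δ : ℝ} (hδ : 0 < δ) (N : ℕ) :
    ∃ j k, N ≤ j ∧ j < k ∧ ‖v j - v k‖ < δ := by
  obtain ⟨a, -, s, hs, ha⟩ := tendsto_subseq_of_bounded
    (Metric.isBounded_closedBall (x := (0 : E)) (r := C)) (x := v) (fun n => by simpa using hv n)
  obtain ⟨M, hM⟩ := Metric.cauchySeq_iff.1 ha.cauchySeq δ hδ
  refine ⟨s (max M N), s (max M N + 1), ?_, hs (Nat.lt_succ_self _), ?_⟩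
  · exact (le_max_right M N).trans hs.le_apply
  · rw [← dist_eq_norm]
    exact hM _ (le_max_left M N) _ (by omega)

section Thickness

variable {V : Type*} [NormedAddCommGroup V]

theorem whitley_le_of_finset {ε : ℝ} (hε : 0 < ε) (F : Finset V) (hF : ∀ f ∈ F, ‖f‖ = 1)
    (h : ∀ x : V, ‖x‖ = 1 → ∃ f ∈ F, ‖x - f‖ ≤ ε) : whitley V ≤ ε :=
  csInf_le ⟨0, fun _ h => h.1.le⟩ ⟨hε, F, hF, h⟩

theorem two_mem_whitley_set {u : V} (hu : ‖u‖ = 1) :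
    (2 : ℝ) ∈ {ε : ℝ | 0 < ε ∧ ∃ F : Finset V, (∀ f ∈ F, ‖f‖ = 1) ∧
      ∀ x : V, ‖x‖ = 1 → ∃ f ∈ F, ‖x - f‖ ≤ ε} := by
  refine ⟨two_pos, {u}, by simpa using hu, fun x hx => ⟨u, by simp, ?_⟩⟩
  linarith [norm_sub_le x u]

theorem whitley_le_two {u : V} (hu : ‖u‖ = 1) : whitley V ≤ 2 :=
  csInf_le ⟨0, fun _ h => h.1.le⟩ (two_mem_whitley_set hu)

theorem le_whitley {u : V} (hu : ‖u‖ = 1) {t : ℝ}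
    (h : ∀ F : Finset V, (∀ f ∈ F, ‖f‖ = 1) → ∃ y, ‖y‖ = 1 ∧ ∀ f ∈ F, t ≤ ‖y - f‖) :
    t ≤ whitley V := by
  refine le_csInf ⟨2, two_mem_whitley_set hu⟩ ?_
  rintro ε ⟨-, F, hF, hnet⟩
  obtain ⟨y, hy, hyF⟩ := h F hF
  obtain ⟨f, hf, hle⟩ := hnet y hy
  exact (hyF f hf).trans hle

theorem one_le_whitley [NormedSpace ℝ V] (hV : ¬ FiniteDimensional ℝ V) : 1 ≤ whitley V := by
  have : Nontrivial V := by
    by_contra h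
    rw [not_nontrivial_iff_subsingleton] at h
    exact hV inferInstance
  obtain ⟨u, hu⟩ := exists_norm_eq V zero_le_one
  refine le_of_forall_lt_imp_le_of_dense fun r hr => le_whitley hu fun F _ => ?_
  have hne : ∃ x : V, x ∉ Submodule.span ℝ (F : Set V) := by
    by_contra! h
    exact hV (Module.finite_def.2 ⟨F, by simpa [Submodule.eq_top_iff'] using h⟩)
  obtain ⟨x, hx, hxF⟩ := riesz_lemma (Submodule.closed_of_finiteDimensional _) hne hr
  have hx0 : x ≠ 0 := fun h => hx (h ▸ Submodule.zero_mem _)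
  have hpos : 0 < ‖x‖ := norm_pos_iff.2 hx0
  refine ⟨‖x‖⁻¹ • x, norm_smul_inv_norm (𝕜 := ℝ) hx0, fun f hf => ?_⟩
  have key := hxF (‖x‖ • f) (Submodule.smul_mem _ _ (Submodule.subset_span hf))
  have hscale : x - ‖x‖ • f = ‖x‖ • (‖x‖⁻¹ • x - f) := by
    rw [smul_sub, smul_smul, mul_inv_cancel₀ hpos.ne', one_smul]
  rw [hscale, norm_smul, norm_norm, mul_comm] at key
  exact le_of_mul_le_mul_left key hpos

end Thickness

/-! ### Renormings from equivalent seminorms -/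

/-- A copy of `X`, to be normed by `p`. -/
def SeminormCopy {X : Type} [NormedAddCommGroup X] [NormedSpace ℝ X] (_p : Seminorm ℝ X) : Type :=
  X

section Renorming

variable {X : Type} [NormedAddCommGroup X] [NormedSpace ℝ X]

instance (p : Seminorm ℝ X) : AddCommGroup (SeminormCopy p) := inferInstanceAs (AddCommGroup X)

instance (p : Seminorm ℝ X) : Module ℝ (SeminormCopy p) := inferInstanceAs (Module ℝ X)

instance (p : Seminorm ℝ X) : Norm (SeminormCopy p) := ⟨fun x => p (show X from x)⟩

theorem exists_renorming [CompleteSpace X] (p : Seminorm ℝ X) {a b : ℝ}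
    (ha : ∀ x, p x ≤ a * ‖x‖) (hb : ∀ x, ‖x‖ ≤ b * p x) :
    ∃ (V : Type) (_ : NormedAddCommGroup V) (_ : NormedSpace ℝ V) (_ : CompleteSpace V)
      (e : X ≃L[ℝ] V), ∀ x, ‖e x‖ = p x := by
  have core : NormedSpace.Core ℝ (SeminormCopy p) :=
    { norm_nonneg := fun x => apply_nonneg p (show X from x)
      norm_smul := fun c x => map_smul_eq_mul p c (show X from x)
      norm_triangle := fun x y => map_add_le_add p (show X from x) (show X from y)
      norm_eq_zero_iff := fun x => by
        refine ⟨fun h => ?_, fun h => h ▸ map_zero p⟩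
        have h0 : p (show X from x) = 0 := h
        have := hb (show X from x)
        rw [h0, mul_zero] at this
        exact norm_le_zero_iff.1 this }
  let := NormedAddCommGroup.ofCore core
  let : NormedSpace ℝ (SeminormCopy p) := NormedSpace.ofCore core
  let e₀ : X ≃ₗ[ℝ] SeminormCopy p := LinearEquiv.refl ℝ X
  let e : X ≃L[ℝ] SeminormCopy p := e₀.toContinuousLinearEquivOfBounds a b ha hb
  have : CompleteSpace (SeminormCopy p) :=
    (completeSpace_congr (e := e.toEquiv) e.isUniformEmbedding).1 inferInstance
  exact ⟨SeminormCopy p, inferInstance, inferInstance, this, e, fun _ => rfl⟩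

/-! ### A renorming with thickness at most one -/

theorem exists_whitley_le_one [CompleteSpace X] [Nontrivial X] :
    ∃ (V : Type) (_ : NormedAddCommGroup V) (_ : NormedSpace ℝ V) (_ : CompleteSpace V)
      (_ : X ≃L[ℝ] V), whitley V ≤ 1 := by
  obtain ⟨u, hu⟩ := exists_norm_eq X zero_le_one
  obtain ⟨φ, hφ, hφu⟩ := exists_dual_vector' ℝ u
  simp only [hu, RCLike.ofReal_real_eq_id, id] at hφu
  let P : X →ₗ[ℝ] X := LinearMap.id - (φ : X →ₗ[ℝ] ℝ).smulRight u
  let p : Seminorm ℝ X := (φ : X →ₗ[ℝ] ℝ).toSeminorm ⊔ (normSeminorm ℝ X).comp P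
  have hp : ∀ x, p x = max |φ x| ‖x - φ x • u‖ := fun x => rfl
  have hφx : ∀ x, |φ x| ≤ ‖x‖ := fun x => by simpa [hφ] using φ.le_opNorm x
  have hsmul : ∀ x, ‖φ x • u‖ = |φ x| := fun x => by rw [norm_smul, hu, mul_one, Real.norm_eq_abs]
  obtain ⟨V, nV, sV, cV, e, he⟩ := exists_renorming p (a := 2) (b := 2)
    (fun x => by
      rw [hp]
      refine max_le ?_ ?_
      · linarith [hφx x, norm_nonneg x]
      · linarith [hφx x, norm_sub_le x (φ x • u), hsmul x])
    (fun x => by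
      have h₁ := norm_add_le (x - φ x • u) (φ x • u)
      rw [sub_add_cancel, hsmul] at h₁
      rw [hp]
      linarith [le_max_left |φ x| ‖x - φ x • u‖, le_max_right |φ x| ‖x - φ x • u‖])
  have hpu : p u = 1 := by simp [hp, hφu]
  classical
  refine ⟨V, nV, sV, cV, e, whitley_le_of_finset one_pos {e u, -e u} ?_ fun y hy => ?_⟩
  · simp [he, hpu]
  · obtain ⟨x, rfl⟩ := e.surjective y
    rw [he, hp] at hy
    have h₁ : |φ x| ≤ 1 := hy ▸ le_max_left _ _
    have h₂ : ‖x - φ x • u‖ ≤ 1 := hy ▸ le_max_right _ _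
    rw [abs_le] at h₁
    rcases le_total 0 (φ x) with h | h
    · refine ⟨e u, by simp, ?_⟩
      rw [← map_sub, he, hp]
      refine max_le ?_ ?_
      · rw [map_sub, hφu, abs_le]
        constructor <;> linarith
      · have : x - u - φ (x - u) • u = x - φ x • u := by
          rw [map_sub, hφu, sub_smul, one_smul]; abel
        rwa [this]
    · refine ⟨-e u, by simp, ?_⟩
      rw [sub_neg_eq_add, ← map_add, he, hp]
      refine max_le ?_ ?_
      · rw [map_add, hφu, abs_le]
        constructor <;> linarith
      · have : x + u - φ (x + u) • u = x - φ x • u := by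
          rw [map_add, hφu, add_smul, one_smul]; abel
        rwa [this]

/-! ### Bounded biorthogonal sequences -/

theorem exists_dual_annihilating (E : Submodule ℝ X) {x : X} {r : ℝ} (hr : 0 < r)
    (hx : ∀ y ∈ E, r ≤ ‖x - y‖) :
    ∃ φ : X →L[ℝ] ℝ, ‖φ‖ ≤ r⁻¹ ∧ φ x = 1 ∧ ∀ y ∈ E, φ y = 0 := by
  have hd : r ≤ ‖E.mkQL x‖ := by
    refine le_of_forall_pos_le_add fun ε hε => ?_
    obtain ⟨m, hm, hmn⟩ := Submodule.Quotient.norm_mk_lt (E.mkQL x) hε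
    have hmem : x - m ∈ E := (Submodule.Quotient.eq E).1 hm.symm
    have := hx _ hmem
    rw [sub_sub_cancel] at this
    linarith
  have hpos : 0 < ‖E.mkQL x‖ := hr.trans_le hd
  obtain ⟨g, hg, hgx⟩ := exists_dual_vector ℝ (E.mkQL x) hpos.ne'
  refine ⟨‖E.mkQL x‖⁻¹ • g.comp E.mkQL, ?_, ?_, fun y hy => ?_⟩
  · refine ContinuousLinearMap.opNorm_le_bound _ (by positivity) fun y => ?_
    have h₁ : ‖g (E.mkQL y)‖ ≤ ‖y‖ := by
      have h := g.le_opNorm (E.mkQL y)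
      rw [hg, one_mul] at h
      exact h.trans (Submodule.Quotient.norm_mk_le E y)
    simp only [smul_apply, ContinuousLinearMap.comp_apply, norm_smul, norm_inv,
      norm_norm]
    gcongr
  · simp only [smul_apply, ContinuousLinearMap.comp_apply, hgx, smul_eq_mul]
    exact inv_mul_cancel₀ hpos.ne'
  · have : E.mkQL y = 0 := (Submodule.Quotient.mk_eq_zero E).2 hy
    simp [this]

theorem exists_far_mem_of_finite_codim (hX : ¬ FiniteDimensional ℝ X) {W : Type*} [AddCommGroup W]
    [Module ℝ W] [FiniteDimensional ℝ W] (T : X →ₗ[ℝ] W) (E : Submodule ℝ X)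
    [FiniteDimensional ℝ E] :
    ∃ x : X, ‖x‖ ≤ 3 ∧ T x = 0 ∧ ∀ y ∈ E, 1 / 4 ≤ ‖x - y‖ := by
  have hker : ¬ FiniteDimensional ℝ (LinearMap.ker T) := fun h => by
    have : Module.Finite ℝ (X ⧸ LinearMap.ker T) := Module.Finite.equiv T.quotKerEquivRange.symm
    exact hX (Module.Finite.of_submodule_quotient (LinearMap.ker T))
  obtain ⟨f, hf, hsep⟩ := exists_seq_norm_le_one_le_norm_sub' (𝕜 := ℝ) (c := 2) (R := 3)
    (by norm_num) (by norm_num) hker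
  by_contra! hcon
  have hclose : ∀ n, ∃ y : E, ‖(f n : X) - y‖ < 1 / 4 := fun n => by
    obtain ⟨y, hy, hlt⟩ := hcon (f n) (hf n) (f n).2
    exact ⟨⟨y, hy⟩, hlt⟩
  choose y hy using hclose
  have hyb : ∀ n, ‖y n‖ ≤ 4 := fun n => by
    have h₁ := norm_sub_norm_le (y n : X) (f n)
    have h₂ := hy n
    rw [norm_sub_rev] at h₂
    have h₃ : ‖(f n : X)‖ ≤ 3 := hf n
    change ‖(y n : X)‖ ≤ 4
    linarith
  obtain ⟨j, k, -, hjk, hlt⟩ := exists_lt_dist_lt_of_norm_le hyb (δ := 1 / 2) (by norm_num) 0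
  have h₁ : (1 : ℝ) ≤ ‖(f j : X) - f k‖ := hsep hjk.ne
  have h₂ : ‖(y j : X) - y k‖ < 1 / 2 := hlt
  have h₃ : (f j : X) - f k = (f j - y j) + (y j - y k) - (f k - y k) := by abel
  have h₄ := norm_sub_le ((f j - y j : X) + (y j - y k)) (f k - y k)
  rw [← h₃] at h₄
  linarith [norm_add_le (f j - y j : X) (y j - y k), hy j, hy k]

theorem exists_bounded_biorthogonal (hX : ¬ FiniteDimensional ℝ X) :
    ∃ (e : ℕ → X) (φ : ℕ → X →L[ℝ] ℝ), (∀ n, ‖e n‖ ≤ 3) ∧ (∀ n, ‖φ n‖ ≤ 4) ∧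
      (∀ n, φ n (e n) = 1) ∧ ∀ m n, m ≠ n → φ m (e n) = 0 := by
  obtain ⟨s, hs, hr⟩ := exists_seq_of_forall_finset_exists
    (fun q : X × (X →L[ℝ] ℝ) => ‖q.1‖ ≤ 3 ∧ ‖q.2‖ ≤ 4 ∧ q.2 q.1 = 1)
    (fun q q' => q.2 q'.1 = 0 ∧ q'.2 q.1 = 0) (fun S _ => by
      classical
      let E : Submodule ℝ X := Submodule.span ℝ (S.image Prod.fst : Finset X)
      obtain ⟨x, hx, hT, hxE⟩ := exists_far_mem_of_finite_codim hX
        (LinearMap.pi fun q : S => (q.1.2 : X →ₗ[ℝ] ℝ)) E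
      obtain ⟨φ, hφ, hφx, hφE⟩ := exists_dual_annihilating E (by norm_num) hxE
      refine ⟨(x, φ), ⟨hx, by simpa using hφ, hφx⟩, fun q hq => ⟨?_, ?_⟩⟩
      · exact congrFun hT ⟨q, hq⟩
      · refine hφE _ (Submodule.subset_span ?_)
        exact Finset.mem_coe.2 (Finset.mem_image_of_mem _ hq))
  refine ⟨fun n => (s n).1, fun n => (s n).2, fun n => (hs n).1, fun n => (hs n).2.1,
    fun n => (hs n).2.2, fun m n hmn => ?_⟩
  rcases hmn.lt_or_gt with h | h
  · exact (hr m n h).1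
  · exact (hr n m h).2

/-! ### Renormings with thickness close to two -/

/-- The functionals of norm at most `R` whose values along `e` are bounded by `1` and eventually
vanish. -/
def finitelySupportedFunctionals (e : ℕ → X) (R : ℝ) : Set (X →L[ℝ] ℝ) :=
  {ψ | ‖ψ‖ ≤ R ∧ (∀ n, |ψ (e n)| ≤ 1) ∧ ∀ᶠ n in Filter.atTop, ψ (e n) = 0}

theorem neg_mem_finitelySupportedFunctionals {e : ℕ → X} {R : ℝ} {ψ : X →L[ℝ] ℝ}
    (h : ψ ∈ finitelySupportedFunctionals e R) : -ψ ∈ finitelySupportedFunctionals e R := by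
  obtain ⟨h₁, h₂, h₃⟩ := h
  exact ⟨by simpa using h₁, by simpa using h₂, by simpa using h₃⟩

/-- Shrinking a functional and adding a difference of two biorthogonal functionals supported away
from it stays in the norming set. -/
theorem smul_add_sub_mem_finitelySupportedFunctionals {e : ℕ → X} {φ : ℕ → X →L[ℝ] ℝ}
    (hφ : ∀ n, ‖φ n‖ ≤ 4) (hone : ∀ n, φ n (e n) = 1) (hzero : ∀ m n, m ≠ n → φ m (e n) = 0)
    {δ : ℝ} (hδ : 0 < δ) (hδ1 : δ < 1) {ψ : X →L[ℝ] ℝ}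
    (hψ : ψ ∈ finitelySupportedFunctionals e (8 / δ)) {j k : ℕ} (hjk : j < k)
    (hj : ψ (e j) = 0) (hk : ψ (e k) = 0) :
    (1 - δ) • ψ + (φ j - φ k) ∈ finitelySupportedFunctionals e (8 / δ) := by
  obtain ⟨h₁, h₂, h₃⟩ := hψ
  refine ⟨?_, fun n => ?_, ?_⟩
  · have hsmul : ‖(1 - δ) • ψ‖ ≤ (1 - δ) * (8 / δ) := by
      rw [norm_smul, Real.norm_of_nonneg (by linarith)]
      exact mul_le_mul_of_nonneg_left h₁ (by linarith)
    have hR : (1 - δ) * (8 / δ) + 8 = 8 / δ := by field_simp; ring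
    linarith [norm_add_le ((1 - δ) • ψ) (φ j - φ k), norm_sub_le (φ j) (φ k), hφ j, hφ k]
  · simp only [add_apply, smul_apply,
      sub_apply, smul_eq_mul]
    rcases eq_or_ne n j with rfl | hnj
    · simp [hj, hone, hzero k n hjk.ne']
    · rcases eq_or_ne n k with rfl | hnk
      · simp [hk, hone, hzero j n hjk.ne]
      · rw [hzero j n hnj.symm, hzero k n hnk.symm, sub_zero, add_zero, abs_mul,
          abs_of_pos (by linarith : 0 < 1 - δ)]
        nlinarith [h₂ n, abs_nonneg (ψ (e n))]
  · filter_upwards [h₃, Filter.eventually_gt_atTop k] with n hn hkn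
    simp [hn, hzero j n (by omega), hzero k n (by omega)]

theorem exists_thick_seminorm (hX : ¬ FiniteDimensional ℝ X) {δ : ℝ} (hδ : 0 < δ) (hδ1 : δ < 1) :
    ∃ (p : Seminorm ℝ X) (a b : ℝ), (∀ x, p x ≤ a * ‖x‖) ∧ (∀ x, ‖x‖ ≤ b * p x) ∧
      ∀ F : Finset X, (∀ f ∈ F, p f = 1) → ∃ y, p y = 1 ∧ ∀ f ∈ F, 2 - 9 * δ ≤ p (y - f) := by
  obtain ⟨e, φ, he, hφ, hone, hzero⟩ := exists_bounded_biorthogonal hX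
  set K := finitelySupportedFunctionals e (8 / δ)
  have hR : 8 ≤ 8 / δ := by rw [le_div_iff₀ hδ]; linarith
  have hφK : ∀ n, φ n ∈ K := fun n => by
    refine ⟨(hφ n).trans (by linarith), fun m => ?_, ?_⟩
    · rcases eq_or_ne n m with rfl | h
      · simp [hone]
      · simp [hzero n m h]
    · filter_upwards [Filter.eventually_gt_atTop n] with m hm
      exact hzero n m hm.ne
  have : Nonempty K := ⟨⟨φ 0, hφK 0⟩⟩
  have hKle : ∀ (ψ : K) (x : X), |ψ.1 x| ≤ 8 / δ * ‖x‖ := fun ψ x =>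
    (ψ.1.le_opNorm x).trans (mul_le_mul_of_nonneg_right ψ.2.1 (norm_nonneg x))
  let s : K → Seminorm ℝ X := fun ψ => (ψ.1 : X →ₗ[ℝ] ℝ).toSeminorm
  have hbdd : ∀ x, BddAbove (range fun ψ => s ψ x) := fun x =>
    ⟨8 / δ * ‖x‖, forall_mem_range.2 fun ψ => hKle ψ x⟩
  let q : Seminorm ℝ X := ⨆ ψ, s ψ
  have hq : ∀ x, q x = ⨆ ψ : K, |ψ.1 x| := fun x =>
    Seminorm.iSup_apply (Seminorm.bddAbove_range_iff.2 hbdd)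
  have hle_q : ∀ ψ ∈ K, ∀ x, ψ x ≤ q x := fun ψ hψ x => by
    rw [hq]
    exact (le_abs_self _).trans (le_ciSup (hbdd x) ⟨ψ, hψ⟩)
  have hnear : ∀ x, ∃ ψ ∈ K, q x - δ ≤ ψ x := fun x => by
    obtain ⟨ψ, hψ⟩ := exists_lt_of_lt_ciSup (show q x - δ < ⨆ ψ : K, |ψ.1 x| by rw [← hq]; linarith)
    rcases abs_cases (ψ.1 x) with ⟨h, -⟩ | ⟨h, -⟩
    · exact ⟨ψ.1, ψ.2, by linarith⟩
    · exact ⟨-ψ.1, neg_mem_finitelySupportedFunctionals ψ.2, by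
        rw [neg_apply]; linarith⟩
  have hqe : ∀ n, q (e n) = 1 := fun n => by
    refine le_antisymm ?_ ?_
    · rw [hq]
      exact ciSup_le fun ψ => ψ.2.2.1 n
    · exact (hone n).ge.trans (hle_q _ (hφK n) _)
  let p : Seminorm ℝ X := q + δ.toNNReal • normSeminorm ℝ X
  have hp : ∀ x, p x = q x + δ * ‖x‖ := fun x => by
    change q x + (δ.toNNReal : ℝ) * ‖x‖ = _
    rw [Real.coe_toNNReal _ hδ.le]
  refine ⟨p, 8 / δ + δ, 1 / δ, fun x => ?_, fun x => ?_, fun F hF => ?_⟩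
  · have : q x ≤ 8 / δ * ‖x‖ := by
      rw [hq]
      exact ciSup_le fun ψ => hKle ψ x
    rw [hp]
    linarith
  · have : 0 ≤ q x := apply_nonneg q x
    rw [hp, div_mul_eq_mul_div, one_mul, le_div_iff₀ hδ]
    linarith
  choose ψ hψK hψ using fun f : X => hnear (-f)
  have hev : ∀ᶠ n in Filter.atTop, ∀ f ∈ F, ψ f (e n) = 0 :=
    (Filter.eventually_all_finset F).2 fun f _ => (hψK f).2.2
  obtain ⟨N, hN⟩ := Filter.eventually_atTop.1 hev
  let v : ℕ → F → ℝ := fun n f => φ n f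
  have hv : ∀ n, ‖v n‖ ≤ 4 * ∑ f ∈ F, ‖f‖ := fun n => by
    refine (pi_norm_le_iff_of_nonneg (by positivity)).2 fun f => ?_
    refine ((φ n).le_opNorm f).trans ?_
    gcongr
    · exact hφ n
    · exact Finset.single_le_sum (f := fun f : X => ‖f‖) (fun _ _ => norm_nonneg _) f.2
  obtain ⟨j, k, hNj, hjk, hclose⟩ := exists_lt_dist_lt_of_norm_le hv hδ N
  have hpe : p (e j) = 1 + δ * ‖e j‖ := by rw [hp, hqe]
  have hδe : δ * ‖e j‖ ≤ 3 * δ := by nlinarith [he j]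
  have hpe1 : 1 ≤ p (e j) := by rw [hpe]; linarith [mul_nonneg hδ.le (norm_nonneg (e j))]
  have hpe0 : 0 < p (e j) := by linarith
  refine ⟨(p (e j))⁻¹ • e j, ?_, fun f hf => ?_⟩
  · rw [map_smul_eq_mul, Real.norm_of_nonneg (by positivity), inv_mul_cancel₀ hpe0.ne']
  have hdiff : p (e j - (p (e j))⁻¹ • e j) ≤ 3 * δ := by
    have h₁ : e j - (p (e j))⁻¹ • e j = (1 - (p (e j))⁻¹) • e j := by rw [sub_smul, one_smul]
    have h₂ : (p (e j))⁻¹ ≤ 1 := inv_le_one_of_one_le₀ hpe1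
    rw [h₁, map_smul_eq_mul, Real.norm_of_nonneg (by linarith), sub_mul, one_mul,
      inv_mul_cancel₀ hpe0.ne', hpe]
    linarith
  have hmain : 2 - 6 * δ ≤ p (e j - f) := by
    have hθ := hle_q _ (smul_add_sub_mem_finitelySupportedFunctionals hφ hone hzero hδ hδ1
      (hψK f) hjk (hN j hNj f hf) (hN k (hNj.trans hjk.le) f hf)) (e j - f)
    have hvf : |φ j f - φ k f| < δ :=
      (norm_le_pi_norm (v j - v k) ⟨f, hf⟩).trans_lt hclose
    simp only [add_apply, smul_apply,
      sub_apply, smul_eq_mul, map_sub, hN j hNj f hf, hone,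
      hzero k j hjk.ne'] at hθ
    have hψf := hψ f
    rw [map_neg_eq_map, map_neg] at hψf
    have hpf := hF f hf
    rw [hp] at hpf
    have hnorm := norm_sub_norm_le f (e j)
    rw [norm_sub_rev] at hnorm
    have hnorm' : δ * (‖f‖ - ‖e j‖) ≤ δ * ‖e j - f‖ := mul_le_mul_of_nonneg_left hnorm hδ.le
    rw [abs_lt] at hvf
    rw [hp]
    nlinarith [mul_le_mul_of_nonneg_left hψf (by linarith : 0 ≤ 1 - δ),
      mul_nonneg hδ.le (norm_nonneg f), mul_nonneg hδ.le (mul_nonneg hδ.le (norm_nonneg f))]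
  have htri := map_add_le_add p (e j - (p (e j))⁻¹ • e j) ((p (e j))⁻¹ • e j - f)
  rw [sub_add_sub_cancel] at htri
  linarith

theorem exists_le_whitley [CompleteSpace X] (hX : ¬ FiniteDimensional ℝ X) {t : ℝ} (ht : t < 2) :
    ∃ (V : Type) (_ : NormedAddCommGroup V) (_ : NormedSpace ℝ V) (_ : CompleteSpace V)
      (_ : X ≃L[ℝ] V), t ≤ whitley V := by
  obtain ⟨δ, hδ, hδlt⟩ := exists_between (show 0 < min 1 ((2 - t) / 9) by
    exact lt_min one_pos (by linarith))
  have hδt := hδlt.trans_le (min_le_right _ _)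
  obtain ⟨p, a, b, ha, hb, hthick⟩ :=
    exists_thick_seminorm hX hδ (hδlt.trans_le (min_le_left _ _))
  obtain ⟨V, nV, sV, cV, e, he⟩ := exists_renorming p ha hb
  obtain ⟨u, hu, -⟩ := hthick ∅ (by simp)
  refine ⟨V, nV, sV, cV, e, le_whitley (u := e u) (by rw [he, hu]) fun F hF => ?_⟩
  classical
  obtain ⟨y, hy, hyF⟩ := hthick (F.image e.symm) (fun f hf => by
    obtain ⟨g, hg, rfl⟩ := Finset.mem_image.1 hf
    rw [← he, e.apply_symm_apply, hF g hg])
  refine ⟨e y, by rw [he, hy], fun f hf => ?_⟩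
  have := hyF (e.symm f) (Finset.mem_image_of_mem _ hf)
  rw [← he, map_sub, e.apply_symm_apply] at this
  linarith

end Renorming

/-- For every infinite-dimensional Banach space `X`, the infimum of the Whitley
thickness constant over all equivalent renormings of `X` is `1`, and the
supremum is `2`. -/
theorem whitley_renorming_inf_eq_one_sup_eq_two
    (X : Type) [NormedAddCommGroup X] [NormedSpace ℝ X] [CompleteSpace X]
    (hX : ¬ FiniteDimensional ℝ X) :
    sInf {t : ℝ | ∃ (V : Type) (nV : NormedAddCommGroup V) (sV : NormedSpace ℝ V)
        (cV : CompleteSpace V) (e : X ≃L[ℝ] V), t = whitley V} = 1 ∧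
    sSup {t : ℝ | ∃ (V : Type) (nV : NormedAddCommGroup V) (sV : NormedSpace ℝ V)
        (cV : CompleteSpace V) (e : X ≃L[ℝ] V), t = whitley V} = 2 := by
  set S := {t : ℝ | ∃ (V : Type) (_ : NormedAddCommGroup V) (_ : NormedSpace ℝ V)
    (_ : CompleteSpace V) (_ : X ≃L[ℝ] V), t = whitley V}
  have hinf : ∀ {V : Type} [NormedAddCommGroup V] [NormedSpace ℝ V], (X ≃L[ℝ] V) →
      ¬ FiniteDimensional ℝ V := fun e h => hX (Module.Finite.equiv e.symm.toLinearEquiv)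
  have hnontriv : ∀ {V : Type} [NormedAddCommGroup V] [NormedSpace ℝ V], (X ≃L[ℝ] V) →
      Nontrivial V := fun e => by
    by_contra h
    rw [not_nontrivial_iff_subsingleton] at h
    exact hinf e inferInstance
  have hone : ∀ t ∈ S, 1 ≤ t := by
    rintro _ ⟨V, nV, sV, cV, e, rfl⟩
    exact one_le_whitley (hinf e)
  have htwo : ∀ t ∈ S, t ≤ 2 := by
    rintro _ ⟨V, nV, sV, cV, e, rfl⟩
    have := hnontriv e
    obtain ⟨u, hu⟩ := exists_norm_eq V zero_le_one
    exact whitley_le_two hu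
  have hself : whitley X ∈ S := ⟨X, _, _, inferInstance, ContinuousLinearEquiv.refl ℝ X, rfl⟩
  constructor
  · have := hnontriv (ContinuousLinearEquiv.refl ℝ X)
    obtain ⟨V, nV, sV, cV, e, hV⟩ := exists_whitley_le_one (X := X)
    refine le_antisymm ?_ (le_csInf ⟨_, hself⟩ hone)
    exact (csInf_le ⟨1, hone⟩ ⟨V, nV, sV, cV, e, rfl⟩).trans hV
  · refine le_antisymm (csSup_le ⟨_, hself⟩ htwo) (le_of_forall_lt_imp_le_of_dense fun t ht => ?_)
    obtain ⟨V, nV, sV, cV, e, hV⟩ := exists_le_whitley hX ht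
    exact hV.trans (le_csSup ⟨2, htwo⟩ ⟨V, nV, sV, cV, e, rfl⟩)
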